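/- Let 𝒜 be of nonstandard p(·)-growth with constants a₋, b⁺ and assume p⁻ > n. Let f : ℝ → ℝ be a continuous nonnegative strictly convex function with f(t) ≠ 0 for every t ∈ ℝ. Then there exists no bounded supersolution of div 𝒜(x,u,∇u) = f(u) in ℝⁿ. -/

import Mathlib

open MeasureTheory Metric Real
open scoped ContDiff

noncomputable section

abbrev Euc (n : ℕ) := EuclideanSpace ℝ (Fin n)

/-- Measure of the unit ball in `ℝⁿ`. -/
def omegaEuc (n : ℕ) : ℝ := (volume (Metric.ball (0 : Euc n) 1)).toReal

/-- A measurable variable exponent `p` with `p⁻ = pm` and `p⁺ = pP`,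
`1 < p⁻` and `p⁺ < ∞` (encoded by the a.e. bounds). -/
structure IsVarExp {n : ℕ} (p : Euc n → ℝ) (pm pP : ℝ) : Prop where
  meas : Measurable p
  one_lt : 1 < pm
  inf_eq : essInf p (volume : Measure (Euc n)) = pm
  sup_eq : essSup p (volume : Measure (Euc n)) = pP
  ae_lb : ∀ᵐ x ∂(volume : Measure (Euc n)), pm ≤ p x
  ae_ub : ∀ᵐ x ∂(volume : Measure (Euc n)), p x ≤ pP

/-- `𝒜` is of nonstandard `p(·)`-growth with constants `am = a₋`, `bP = b⁺`. -/
structure IsNSGrowth {n : ℕ} (p : Euc n → ℝ) (𝒜 : Euc n → ℝ → Euc n → Euc n)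
    (am bP : ℝ) : Prop where
  am_pos : 0 < am
  meas : ∀ (t : ℝ) (ξ : Euc n), Measurable (fun x => 𝒜 x t ξ)
  cont : ∀ x : Euc n, Continuous (fun tξ : ℝ × Euc n => 𝒜 x tξ.1 tξ.2)
  growth : ∃ a b : Euc n → ℝ, Measurable a ∧ Measurable b ∧
      (∀ x, am ≤ a x ∧ a x ≤ b x ∧ b x ≤ bP) ∧
      (∀ x t ξ, a x * ‖ξ‖ ^ p x ≤ (inner ℝ (𝒜 x t ξ) ξ : ℝ)) ∧
      (∀ x t ξ, ‖𝒜 x t ξ‖ ≤ b x * ‖ξ‖ ^ (p x - 1))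

/-- `u` is `𝒜`-harmonic in `ℝⁿ` (C¹ functions replace `W^{1,p(·)}_loc`). -/
def IsAHarmonic {n : ℕ} (p : Euc n → ℝ) (𝒜 : Euc n → ℝ → Euc n → Euc n)
    (u : Euc n → ℝ) : Prop :=
  ContDiff ℝ 1 u ∧
  LocallyIntegrable (fun x => ‖gradient u x‖ ^ p x) (volume : Measure (Euc n)) ∧
  ∀ φ : Euc n → ℝ, ContDiff ℝ ∞ φ → HasCompactSupport φ →
    ∫ x, (inner ℝ (𝒜 x (u x) (gradient u x)) (gradient φ x) : ℝ) = 0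

/-- `u` is an `𝒜`-subsolution in `ℝⁿ`. -/
def IsASubsolution {n : ℕ} (p : Euc n → ℝ) (𝒜 : Euc n → ℝ → Euc n → Euc n)
    (u : Euc n → ℝ) : Prop :=
  ContDiff ℝ 1 u ∧
  LocallyIntegrable (fun x => ‖gradient u x‖ ^ p x) (volume : Measure (Euc n)) ∧
  ∀ φ : Euc n → ℝ, ContDiff ℝ ∞ φ → HasCompactSupport φ → (∀ x, 0 ≤ φ x) →
    ∫ x, (inner ℝ (𝒜 x (u x) (gradient u x)) (gradient φ x) : ℝ) ≤ 0

/-- `ℬ` is an admissible right-hand side. -/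
structure IsAdmissibleRHS {n : ℕ} (p : Euc n → ℝ) (ℬ : Euc n → ℝ → Euc n → ℝ) : Prop where
  meas : ∀ (t : ℝ) (ξ : Euc n), Measurable (fun x => ℬ x t ξ)
  cont : ∀ x : Euc n, Continuous (fun tξ : ℝ × Euc n => ℬ x tξ.1 tξ.2)
  bound : ∃ c : Euc n → ℝ, Measurable c ∧ (∃ cP : ℝ, ∀ x, c x ≤ cP) ∧
      ∀ x t ξ, |ℬ x t ξ| ≤ c x * (1 + ‖ξ‖ ^ (p x - 1))

/-- `u` is `(𝒜,ℬ)`-harmonic in `ℝⁿ`. -/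
def IsABHarmonic {n : ℕ} (p : Euc n → ℝ) (𝒜 : Euc n → ℝ → Euc n → Euc n)
    (ℬ : Euc n → ℝ → Euc n → ℝ) (u : Euc n → ℝ) : Prop :=
  ContDiff ℝ 1 u ∧
  LocallyIntegrable (fun x => ‖gradient u x‖ ^ p x) (volume : Measure (Euc n)) ∧
  ∀ φ : Euc n → ℝ, ContDiff ℝ ∞ φ → HasCompactSupport φ →
    ∫ x, (inner ℝ (𝒜 x (u x) (gradient u x)) (gradient φ x) : ℝ)
      = ∫ x, ℬ x (u x) (gradient u x) * φ x

/-- `u` is a supersolution of `div 𝒜(x,u,∇u) = f(u)` in `ℝⁿ`. -/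
def IsFSupersolution {n : ℕ} (p : Euc n → ℝ) (𝒜 : Euc n → ℝ → Euc n → Euc n)
    (f : ℝ → ℝ) (u : Euc n → ℝ) : Prop :=
  ContDiff ℝ 1 u ∧
  LocallyIntegrable (fun x => ‖gradient u x‖ ^ p x) (volume : Measure (Euc n)) ∧
  ∀ φ : Euc n → ℝ, ContDiff ℝ ∞ φ → HasCompactSupport φ → (∀ x, 0 ≤ φ x) →
    ∫ x, f (u x) * φ x ≤ - ∫ x, (inner ℝ (𝒜 x (u x) (gradient u x)) (gradient φ x) : ℝ)


open Filter Topology Set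

section Mollification

variable {G : Type*} [NormedAddCommGroup G] [NormedSpace ℝ G] [FiniteDimensional ℝ G]
  [MeasurableSpace G] [BorelSpace G]

theorem norm_normed_convolution_le_indicator {E : Type*} [NormedAddCommGroup E]
    [NormedSpace ℝ E] [CompleteSpace E] (μ : Measure G) [μ.IsAddHaarMeasure]
    (ρ : ContDiffBump (0 : G)) (hρ : ρ.rOut ≤ 1) {g : G → E} (hg : Continuous g) {r S : ℝ}
    (hr : ∀ x, r < ‖x‖ → g x = 0) (hS : ∀ x, ‖g x‖ ≤ S) (x : G) :
    ‖convolution (ρ.normed μ) g (ContinuousLinearMap.lsmul ℝ ℝ) μ x‖ ≤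
      (closedBall (0 : G) (r + 1)).indicator (fun _ => 3 * S) x := by
  by_cases hx : x ∈ closedBall (0 : G) (r + 1)
  · rw [indicator_of_mem hx]
    have h := ρ.dist_normed_convolution_le (μ := μ) (g := g) (x₀ := x) (ε := 2 * S)
      hg.aestronglyMeasurable fun y _ => by
        rw [dist_eq_norm]
        linarith [norm_sub_le (g y) (g x), hS x, hS y]
    rw [dist_eq_norm] at h
    linarith [norm_sub_norm_le (convolution (ρ.normed μ) g (ContinuousLinearMap.lsmul ℝ ℝ) μ x)
      (g x), hS x]
  · rw [indicator_of_notMem hx]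
    have hx' : r + 1 < ‖x‖ := by simpa using hx
    have hz : g x = 0 := hr x (by linarith)
    rw [ρ.normed_convolution_eq_right, hz, norm_zero]
    intro y hy
    rw [hz]
    apply hr
    have : ‖y - x‖ < 1 := by
      rw [← dist_eq_norm]
      exact (mem_ball.1 hy).trans_le hρ
    linarith [norm_sub_norm_le x y, norm_sub_rev x y]

theorem exists_smooth_approx {φ : G → ℝ} (hφ : ContDiff ℝ 1 φ) (hc : HasCompactSupport φ)
    (h0 : ∀ x, 0 ≤ φ x) :
    ∃ (ψ : ℕ → G → ℝ) (r S : ℝ),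
      (∀ k, ContDiff ℝ ∞ (ψ k) ∧ HasCompactSupport (ψ k) ∧ ∀ x, 0 ≤ ψ k x) ∧
      (∀ k x, ‖ψ k x‖ ≤ (closedBall (0 : G) r).indicator (fun _ => S) x) ∧
      (∀ k x, ‖fderiv ℝ (ψ k) x‖ ≤ (closedBall (0 : G) r).indicator (fun _ => S) x) ∧
      (∀ x, Tendsto (fun k => ψ k x) atTop (𝓝 (φ x))) ∧
      ∀ x, Tendsto (fun k => fderiv ℝ (ψ k) x) atTop (𝓝 (fderiv ℝ φ x)) := by
  let μ : Measure G := Measure.addHaar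
  have hpos : ∀ k : ℕ, (0 : ℝ) < 1 / ((k : ℝ) + 1) := fun k => by positivity
  let ρ : ℕ → ContDiffBump (0 : G) := fun k =>
    ⟨1 / ((k : ℝ) + 1) / 2, 1 / ((k : ℝ) + 1), half_pos (hpos k), half_lt_self (hpos k)⟩
  have hρ1 : ∀ k, (ρ k).rOut ≤ 1 := fun k => by
    change 1 / ((k : ℝ) + 1) ≤ 1
    rw [div_le_one (by positivity)]
    linarith [(Nat.cast_nonneg k : (0 : ℝ) ≤ k)]
  have hρ0 : Tendsto (fun k => (ρ k).rOut) atTop (𝓝 0) := tendsto_one_div_add_atTop_nhds_zero_nat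
  have hcd : Continuous (fderiv ℝ φ) := hφ.continuous_fderiv one_ne_zero
  obtain ⟨S₁, hS₁⟩ := hc.exists_bound_of_continuous hφ.continuous
  obtain ⟨S₂, hS₂⟩ := (hc.fderiv ℝ).exists_bound_of_continuous hcd
  obtain ⟨r, hr⟩ := hc.isCompact.isBounded.subset_closedBall (0 : G)
  have hr1 : ∀ x, r < ‖x‖ → φ x = 0 := fun x hx => image_eq_zero_of_notMem_tsupport
    fun h => by simpa [hx.not_ge] using hr h
  have hr2 : ∀ x, r < ‖x‖ → fderiv ℝ φ x = 0 := fun x hx => image_eq_zero_of_notMem_tsupport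
    fun h => by simpa [hx.not_ge] using hr (tsupport_fderiv_subset ℝ h)
  let ψ : ℕ → G → ℝ := fun k => convolution ((ρ k).normed μ) φ (ContinuousLinearMap.lsmul ℝ ℝ) μ
  have hd : ∀ k x, fderiv ℝ (ψ k) x =
      convolution ((ρ k).normed μ) (fderiv ℝ φ) (ContinuousLinearMap.lsmul ℝ ℝ) μ x := by
    intro k x
    have hL : ContinuousLinearMap.precompR G (ContinuousLinearMap.lsmul ℝ ℝ : ℝ →L[ℝ] ℝ →L[ℝ] ℝ)
        = ContinuousLinearMap.lsmul ℝ ℝ := by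
      ext; simp [ContinuousLinearMap.precompR_apply]
    have h := (hc.hasFDerivAt_convolution_right (μ := μ) (ContinuousLinearMap.lsmul ℝ ℝ)
      ((ρ k).continuous_normed (μ := μ)).locallyIntegrable hφ x).fderiv
    rw [hL] at h
    exact h
  have hS : ∀ {a : ℝ}, a ≤ max S₁ S₂ → ∀ x, (closedBall (0 : G) (r + 1)).indicator
      (fun _ => 3 * a) x ≤ (closedBall (0 : G) (r + 1)).indicator (fun _ => 3 * max S₁ S₂) x :=
    fun ha x => indicator_le_indicator (by linarith)
  refine ⟨ψ, r + 1, 3 * max S₁ S₂, fun k => ⟨?_, ?_, fun x => ?_⟩, fun k x => ?_, fun k x => ?_,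
    fun x => ?_, fun x => ?_⟩
  · exact (ρ k).hasCompactSupport_normed.contDiff_convolution_left _ (ρ k).contDiff_normed
      hφ.continuous.locallyIntegrable
  · exact HasCompactSupport.convolution _ (ρ k).hasCompactSupport_normed hc
  · exact integral_nonneg fun y => mul_nonneg ((ρ k).nonneg_normed y) (h0 _)
  · exact (norm_normed_convolution_le_indicator μ (ρ k) (hρ1 k) hφ.continuous hr1 hS₁ x).trans
      (hS (le_max_left _ _) x)
  · rw [hd]
    exact (norm_normed_convolution_le_indicator μ (ρ k) (hρ1 k) hcd hr2 hS₂ x).trans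
      (hS (le_max_right _ _) x)
  · exact ContDiffBump.convolution_tendsto_right_of_continuous hρ0 hφ.continuous x
  · simp_rw [hd]
    exact ContDiffBump.convolution_tendsto_right_of_continuous hρ0 hcd x

theorem integrable_indicator_mul_norm {E : Type*} [NormedAddCommGroup E] {μ : Measure G}
    {v : G → E} (hv : LocallyIntegrable v μ) (r S : ℝ) :
    Integrable (fun x => (closedBall (0 : G) r).indicator (fun _ => S) x * ‖v x‖) μ := by
  have hi : IntegrableOn (fun x => S * ‖v x‖) (closedBall (0 : G) r) μ :=
    (hv.integrableOn_isCompact (isCompact_closedBall (0 : G) r)).norm.const_mul S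
  refine (hi.integrable_indicator isClosed_closedBall.measurableSet).congr
    (Eventually.of_forall fun x => ?_)
  by_cases hx : x ∈ closedBall (0 : G) r
  · simp only [indicator_of_mem hx]
  · simp only [indicator_of_notMem hx, zero_mul]

/-- A weak differential inequality tested against smooth functions extends to `C¹` functions. -/
theorem weak_inequality_of_smooth {μ : Measure G} {F : G → G} {h : G → ℝ}
    (hF : LocallyIntegrable F μ) (hh : LocallyIntegrable h μ)
    (H : ∀ φ : G → ℝ, ContDiff ℝ ∞ φ → HasCompactSupport φ → (∀ x, 0 ≤ φ x) →
      ∫ x, h x * φ x ∂μ ≤ - ∫ x, fderiv ℝ φ x (F x) ∂μ)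
    {φ : G → ℝ} (hφ : ContDiff ℝ 1 φ) (hc : HasCompactSupport φ) (h0 : ∀ x, 0 ≤ φ x) :
    ∫ x, h x * φ x ∂μ ≤ - ∫ x, fderiv ℝ φ x (F x) ∂μ := by
  obtain ⟨ψ, r, S, hψ, hb, hbd, ht, htd⟩ := exists_smooth_approx hφ hc h0
  have h1 : Tendsto (fun k => ∫ x, h x * ψ k x ∂μ) atTop (𝓝 (∫ x, h x * φ x ∂μ)) := by
    refine tendsto_integral_of_dominated_convergence _
      (fun k => hh.aestronglyMeasurable.mul (hψ k).1.continuous.aestronglyMeasurable)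
      (integrable_indicator_mul_norm hh r S) (fun k => Eventually.of_forall fun x => ?_)
      (Eventually.of_forall fun x => (ht x).const_mul _)
    rw [norm_mul, mul_comm]
    exact mul_le_mul_of_nonneg_right (hb k x) (norm_nonneg _)
  have h2 : Tendsto (fun k => ∫ x, fderiv ℝ (ψ k) x (F x) ∂μ) atTop
      (𝓝 (∫ x, fderiv ℝ φ x (F x) ∂μ)) := by
    refine tendsto_integral_of_dominated_convergence _
      (fun k => ?_) (integrable_indicator_mul_norm hF r S) (fun k => Eventually.of_forall fun x => ?_)
      (Eventually.of_forall fun x =>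
        ((ContinuousLinearMap.apply ℝ ℝ (F x)).continuous.tendsto _).comp (htd x))
    · have : Continuous (fderiv ℝ (ψ k)) := (hψ k).1.continuous_fderiv (by simp)
      exact (ContinuousLinearMap.apply ℝ ℝ).flip.aestronglyMeasurable_comp₂
        this.aestronglyMeasurable hF.aestronglyMeasurable
    · exact (ContinuousLinearMap.le_opNorm _ _).trans
        (mul_le_mul_of_nonneg_right (hbd k x) (norm_nonneg _))
  exact le_of_tendsto_of_tendsto' h1 h2.neg fun k => H _ (hψ k).1 (hψ k).2.1 (hψ k).2.2

end Mollification

/-- Smooth cutoff functions between the balls of radii `R` and `2 R`, with gradient `O(1 / R)`. -/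
theorem exists_cutoff (G : Type*) [NormedAddCommGroup G] [NormedSpace ℝ G]
    [FiniteDimensional ℝ G] :
    ∃ K : ℝ, 0 ≤ K ∧ ∀ R : ℝ, 0 < R → ∃ η : G → ℝ, ContDiff ℝ ∞ η ∧
      (∀ x, 0 ≤ η x ∧ η x ≤ 1) ∧ (∀ x, ‖x‖ ≤ R → η x = 1) ∧ (∀ x, 2 * R ≤ ‖x‖ → η x = 0) ∧
      ∀ x, ‖fderiv ℝ η x‖ ≤ K / R := by
  let ρ : ContDiffBump (0 : G) := ⟨1, 2, one_pos, one_lt_two⟩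
  have hρ : ContDiff ℝ ∞ ρ := ρ.contDiff
  obtain ⟨K, hK⟩ := (ρ.hasCompactSupport.fderiv ℝ).exists_bound_of_continuous
    (hρ.continuous_fderiv (by simp))
  refine ⟨K, (norm_nonneg _).trans (hK 0), fun R hR => ⟨fun x => ρ (R⁻¹ • x),
    hρ.comp (contDiff_const_smul _), fun x => ⟨ρ.nonneg, ρ.le_one⟩, fun x hx => ?_, fun x hx => ?_,
    fun x => ?_⟩⟩
  · apply ρ.one_of_mem_closedBall
    rw [mem_closedBall_zero_iff, norm_smul, norm_inv, Real.norm_of_nonneg hR.le,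
      inv_mul_le_iff₀ hR]
    change ‖x‖ ≤ R * 1
    rwa [mul_one]
  · apply ρ.zero_of_le_dist
    rw [dist_zero_right, norm_smul, norm_inv, Real.norm_of_nonneg hR.le, le_inv_mul_iff₀ hR]
    change R * 2 ≤ _
    linarith
  · have hd : HasFDerivAt (fun x => ρ (R⁻¹ • x))
        ((fderiv ℝ ρ (R⁻¹ • x)).comp (R⁻¹ • ContinuousLinearMap.id ℝ G)) x :=
      ((hρ.differentiable (by simp)) (R⁻¹ • x)).hasFDerivAt.comp x
        ((hasFDerivAt_id x).const_smul R⁻¹)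
    rw [hd.fderiv, ContinuousLinearMap.comp_smul, ContinuousLinearMap.comp_id, norm_smul, norm_inv,
      Real.norm_of_nonneg hR.le, div_eq_inv_mul]
    exact mul_le_mul_of_nonneg_left (hK _) (inv_nonneg.2 hR.le)

/-- Absorption inequality of Young type for the Caccioppoli estimate. -/
theorem absorption_inequality {D α t g e r P : ℝ} {m : ℕ} (hD : 0 ≤ D) (hα : 0 < α) (ht : 0 ≤ t)
    (ht1 : t ≤ 1) (hg : 0 ≤ g) (he : 0 ≤ e) (he1 : e ≤ 1) (hr : 1 ≤ r) (hrP : r ≤ P)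
    (hP : P - 1 ≤ m) :
    D * (e ^ m * g ^ (r - 1) * t) ≤
      α * (e ^ (m + 1) * g ^ r) + D * max 1 (D / α) ^ (P - 1) * t := by
  have hgr : 0 ≤ g ^ (r - 1) := Real.rpow_nonneg hg _
  have hX : 0 ≤ e ^ m * g ^ (r - 1) := by positivity
  rcases le_total (D * t) (α * (g * e)) with h | h
  · have h1 : g ^ r = g ^ (r - 1) * g := by
      rcases hg.eq_or_lt with h0 | h0
      · rw [← h0, Real.zero_rpow (by linarith), mul_zero]
      · rw [← Real.rpow_add_one h0.ne', sub_add_cancel]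
    have h2 := mul_le_mul_of_nonneg_left h hX
    have h3 : 0 ≤ D * max 1 (D / α) ^ (P - 1) * t := by positivity
    rw [h1, pow_succ]
    nlinarith
  · have h1 : e ^ m * g ^ (r - 1) ≤ max 1 (D / α) ^ (P - 1) := by
      have hm : e ^ m ≤ e ^ (r - 1) := by
        rcases he.eq_or_lt with h0 | h0
        · rcases Nat.eq_zero_or_pos m with rfl | hm0
          · have : r - 1 = 0 := by
              push_cast at hP
              linarith
            simp [this]
          · rw [← h0, zero_pow hm0.ne']
            positivity
        · rw [← Real.rpow_natCast]
          exact Real.rpow_le_rpow_of_exponent_ge h0 he1 (by linarith)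
      have hge : e * g ≤ max 1 (D / α) := by
        refine le_trans ?_ (le_max_right _ _)
        rw [le_div_iff₀ hα]
        nlinarith
      calc e ^ m * g ^ (r - 1) ≤ e ^ (r - 1) * g ^ (r - 1) := mul_le_mul_of_nonneg_right hm hgr
        _ = (e * g) ^ (r - 1) := (Real.mul_rpow he hg).symm
        _ ≤ max 1 (D / α) ^ (r - 1) :=
          Real.rpow_le_rpow (by positivity) hge (by linarith)
        _ ≤ max 1 (D / α) ^ (P - 1) :=
          Real.rpow_le_rpow_of_exponent_le (le_max_left _ _) (by linarith)
    have h2 := mul_le_mul_of_nonneg_left h1 (mul_nonneg hD ht)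
    have h3 : 0 ≤ α * (e ^ (m + 1) * g ^ r) := by positivity
    nlinarith

section Growth

variable {n : ℕ} {p : Euc n → ℝ} {pm pP : ℝ} {𝒜 : Euc n → ℝ → Euc n → Euc n} {am bP : ℝ}
  {u : Euc n → ℝ}

theorem continuous_gradient (hu : ContDiff ℝ 1 u) : Continuous (gradient u) :=
  (LinearIsometryEquiv.continuous _).comp (hu.continuous_fderiv one_ne_zero)

theorem IsNSGrowth.am_le_bP (h𝒜 : IsNSGrowth p 𝒜 am bP) : am ≤ bP := by
  obtain ⟨a, b, -, -, hab, -⟩ := h𝒜.growth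
  obtain ⟨h1, h2, h3⟩ := hab 0
  linarith

theorem IsNSGrowth.le_inner (h𝒜 : IsNSGrowth p 𝒜 am bP) (x : Euc n) (t : ℝ) (ξ : Euc n) :
    am * ‖ξ‖ ^ p x ≤ inner ℝ (𝒜 x t ξ) ξ := by
  obtain ⟨a, b, -, -, hab, hl, -⟩ := h𝒜.growth
  exact (mul_le_mul_of_nonneg_right (hab x).1 (by positivity)).trans (hl x t ξ)

theorem IsNSGrowth.norm_le (h𝒜 : IsNSGrowth p 𝒜 am bP) (x : Euc n) (t : ℝ) (ξ : Euc n) :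
    ‖𝒜 x t ξ‖ ≤ bP * ‖ξ‖ ^ (p x - 1) := by
  obtain ⟨a, b, -, -, hab, -, hu⟩ := h𝒜.growth
  exact (hu x t ξ).trans (mul_le_mul_of_nonneg_right (hab x).2.2 (by positivity))

/-- The vector field `x ↦ 𝒜(x, u(x), ∇u(x))` is locally integrable. -/
theorem IsNSGrowth.locallyIntegrable (h𝒜 : IsNSGrowth p 𝒜 am bP) (hp : IsVarExp p pm pP)
    (hu : ContDiff ℝ 1 u) : LocallyIntegrable (fun x => 𝒜 x (u x) (gradient u x)) := by
  have hgc := continuous_gradient hu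
  have hm : Measurable (fun x => 𝒜 x (u x) (gradient u x)) := by
    have h1 : Measurable (Function.uncurry fun (tξ : ℝ × Euc n) (x : Euc n) => 𝒜 x tξ.1 tξ.2) :=
      measurable_uncurry_of_continuous_of_measurable h𝒜.cont fun tξ => h𝒜.meas tξ.1 tξ.2
    exact h1.comp ((hu.continuous.measurable.prodMk hgc.measurable).prodMk measurable_id)
  have hdom : Continuous fun x => bP * (1 + ‖gradient u x‖) ^ (pP - 1) :=
    continuous_const.mul ((continuous_const.add hgc.norm).rpow_const
      fun x => Or.inl (add_pos_of_pos_of_nonneg one_pos (norm_nonneg _)).ne')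
  refine hdom.locallyIntegrable.mono hm.aestronglyMeasurable ?_
  filter_upwards [hp.ae_lb, hp.ae_ub] with x h1 h2
  have hb : 0 ≤ bP := h𝒜.am_pos.le.trans h𝒜.am_le_bP
  refine (h𝒜.norm_le x _ _).trans (le_trans ?_ (le_abs_self _))
  refine mul_le_mul_of_nonneg_left ?_ hb
  have h3 := hp.one_lt
  calc ‖gradient u x‖ ^ (p x - 1) ≤ (1 + ‖gradient u x‖) ^ (p x - 1) :=
        Real.rpow_le_rpow (norm_nonneg _) (by linarith) (by linarith)
    _ ≤ (1 + ‖gradient u x‖) ^ (pP - 1) :=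
        Real.rpow_le_rpow_of_exponent_le (by linarith [norm_nonneg (gradient u x)]) (by linarith)

/-- Pointwise upper bound for the negated flux of `u` tested with `v η ^ (m + 1)`, where `∇v = ∇u`. -/
theorem IsNSGrowth.neg_flux_le (h𝒜 : IsNSGrowth p 𝒜 am bP) {v η : Euc n → ℝ} {L : ℝ} {m : ℕ}
    {x : Euc n} (hv : HasFDerivAt v (fderiv ℝ u x) x) (hη : DifferentiableAt ℝ η x)
    (hv1 : 1 ≤ v x) (hvL : v x ≤ L) (hη0 : 0 ≤ η x) (hη1 : η x ≤ 1)
    (hdη : ‖fderiv ℝ η x‖ ≤ 1) (hp1 : 1 ≤ p x) (hpP : p x ≤ pP) (hm : pP - 1 ≤ m) :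
    -(fderiv ℝ (fun y => v y * η y ^ (m + 1)) x (𝒜 x (u x) (gradient u x))) ≤
      L * (m + 1) * bP * max 1 (L * (m + 1) * bP / am) ^ (pP - 1) * ‖fderiv ℝ η x‖ := by
  have hb : 0 ≤ bP := h𝒜.am_pos.le.trans h𝒜.am_le_bP
  have hL : 0 ≤ L := by linarith
  set A := 𝒜 x (u x) (gradient u x) with hA
  set g := ‖gradient u x‖ with hg
  have hd := (hv.mul (hη.hasFDerivAt.pow (m + 1))).fderiv
  have hd' : fderiv ℝ (fun y => v y * η y ^ (m + 1)) x A =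
      v x * ((m + 1) * η x ^ m * fderiv ℝ η x A) + η x ^ (m + 1) * fderiv ℝ u x A := by
    have : (fun y => v y * η y ^ (m + 1)) = v * fun y => η y ^ (m + 1) := rfl
    rw [this, hd]
    simp
  have h1 : am * g ^ p x ≤ fderiv ℝ u x A := by
    have := h𝒜.le_inner x (u x) (gradient u x)
    rwa [inner_gradient_right] at this
  have h2 : -(fderiv ℝ η x A) ≤ bP * g ^ (p x - 1) * ‖fderiv ℝ η x‖ := by
    have h3 : -(fderiv ℝ η x A) ≤ ‖fderiv ℝ η x‖ * ‖A‖ :=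
      (neg_le_abs _).trans ((fderiv ℝ η x).le_opNorm A)
    have h4 := mul_le_mul_of_nonneg_left (h𝒜.norm_le x (u x) (gradient u x))
      (norm_nonneg (fderiv ℝ η x))
    linarith
  have h5 := absorption_inequality (D := L * (m + 1) * bP) (α := am) (by positivity) h𝒜.am_pos
    (norm_nonneg (fderiv ℝ η x)) hdη (norm_nonneg (gradient u x)) hη0 hη1 hp1 hpP hm
  have h6 := mul_le_mul_of_nonneg_left h1 (pow_nonneg hη0 (m + 1))
  have h7 : v x * ((m + 1) * η x ^ m) * -(fderiv ℝ η x A) ≤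
      L * ((m + 1) * η x ^ m) * (bP * g ^ (p x - 1) * ‖fderiv ℝ η x‖) := by
    calc _ ≤ v x * ((m + 1) * η x ^ m) * (bP * g ^ (p x - 1) * ‖fderiv ℝ η x‖) :=
          mul_le_mul_of_nonneg_left h2 (by positivity)
      _ ≤ _ := by gcongr
  rw [hd']
  linarith

end Growth

/-- A bounded `u` with `div 𝒜(x,u,∇u) ≥ c > 0` satisfies `c R ≤ C` for all large `R`. -/
theorem IsFSupersolution.exists_mul_le {n : ℕ} {p : Euc n → ℝ} {pm pP : ℝ}
    {𝒜 : Euc n → ℝ → Euc n → Euc n} {am bP : ℝ} {f : ℝ → ℝ} {u : Euc n → ℝ} {M c : ℝ}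
    (hu : IsFSupersolution p 𝒜 f u) (hp : IsVarExp p pm pP) (h𝒜 : IsNSGrowth p 𝒜 am bP)
    (hfc : Continuous f) (hM : ∀ x, |u x| ≤ M) (hc0 : 0 ≤ c) (hc : ∀ x, c ≤ f (u x)) :
    ∃ C R₀ : ℝ, ∀ R, R₀ ≤ R → c * R ≤ C := by
  obtain ⟨hu1, -, hweak⟩ := hu
  have hb : 0 ≤ bP := h𝒜.am_pos.le.trans h𝒜.am_le_bP
  have hM0 : 0 ≤ M := (abs_nonneg _).trans (hM 0)
  obtain ⟨m, hm⟩ := exists_nat_ge (pP - 1)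
  obtain ⟨K, hK0, hK⟩ := exists_cutoff (Euc n)
  set D : ℝ := (2 * M + 1) * (m + 1) * bP * max 1 ((2 * M + 1) * (m + 1) * bP / am) ^ (pP - 1)
    with hD
  have hD0 : 0 ≤ D := by positivity
  refine ⟨D * K * 2 ^ n, max 1 K, fun R hR => ?_⟩
  have hR1 : 1 ≤ R := (le_max_left _ _).trans hR
  have hR0 : 0 < R := by linarith
  have hKR : K / R ≤ 1 := (div_le_one hR0).2 ((le_max_right _ _).trans hR)
  obtain ⟨η, hη, hη01, hη1, hη0, hdη⟩ := hK R hR0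
  have hv1 : ∀ x, 1 ≤ u x + (M + 1) := fun x => by linarith [(abs_le.1 (hM x)).1]
  have hvL : ∀ x, u x + (M + 1) ≤ 2 * M + 1 := fun x => by linarith [(abs_le.1 (hM x)).2]
  set φ : Euc n → ℝ := fun x => (u x + (M + 1)) * η x ^ (m + 1) with hφ
  have hφ1 : ContDiff ℝ 1 φ :=
    (hu1.add contDiff_const).mul ((hη.of_le (by simp)).pow (m + 1))
  have hφ0 : ∀ x, 0 ≤ φ x := fun x =>
    mul_nonneg (by linarith [hv1 x]) (pow_nonneg (hη01 x).1 _)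
  have hφz : ∀ x, x ∉ closedBall (0 : Euc n) (2 * R) → φ x = 0 := fun x hx => by
    have : η x = 0 := hη0 x (by simpa using (not_le.1 (mt mem_closedBall_zero_iff.2 hx)).le)
    simp [hφ, this]
  have hφc : HasCompactSupport φ := HasCompactSupport.intro (isCompact_closedBall _ _) hφz
  have hmain := weak_inequality_of_smooth (h𝒜.locallyIntegrable hp hu1)
    (hfc.comp hu1.continuous).locallyIntegrable
    (fun ψ h1 h2 h3 => by simpa [inner_gradient_right] using hweak ψ h1 h2 h3) hφ1 hφc hφ0
  have hlow : c * volume.real (closedBall (0 : Euc n) R) ≤ ∫ x, (f ∘ u) x * φ x := by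
    have hind : ∫ x, (closedBall (0 : Euc n) R).indicator (fun _ => c) x =
        c * volume.real (closedBall (0 : Euc n) R) := by
      rw [integral_indicator_const _ isClosed_closedBall.measurableSet, smul_eq_mul, mul_comm]
    rw [← hind]
    refine integral_mono ?_ ?_ fun x => ?_
    · exact (integrable_indicator_iff isClosed_closedBall.measurableSet).2
        (integrableOn_const measure_closedBall_lt_top.ne)
    · exact ((hfc.comp hu1.continuous).mul hφ1.continuous).integrable_of_hasCompactSupport
        hφc.mul_left
    · refine indicator_le' (g := fun x => (f ∘ u) x * φ x) (fun x hx => ?_) (fun x _ => ?_) x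
      · have : η x = 1 := hη1 x (mem_closedBall_zero_iff.1 hx)
        simp only [hφ, this, one_pow, mul_one, Function.comp]
        nlinarith [hc x, hv1 x]
      · exact mul_nonneg (hc0.trans (hc x)) (hφ0 x)
  have hupp : -∫ x, fderiv ℝ φ x (𝒜 x (u x) (gradient u x)) ≤
      D * (K / R) * volume.real (closedBall (0 : Euc n) (2 * R)) := by
    by_cases hi : Integrable fun x => fderiv ℝ φ x (𝒜 x (u x) (gradient u x))
    swap
    · rw [integral_undef hi, neg_zero]
      positivity
    have hind : ∫ x, (closedBall (0 : Euc n) (2 * R)).indicator (fun _ => D * (K / R)) x =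
        D * (K / R) * volume.real (closedBall (0 : Euc n) (2 * R)) := by
      rw [integral_indicator_const _ isClosed_closedBall.measurableSet, smul_eq_mul, mul_comm]
    rw [← hind, ← integral_neg]
    refine integral_mono_ae hi.neg ?_ ?_
    · exact (integrable_indicator_iff isClosed_closedBall.measurableSet).2
        (integrableOn_const measure_closedBall_lt_top.ne)
    · filter_upwards [hp.ae_lb, hp.ae_ub] with x h1 h2
      by_cases hx : x ∈ closedBall (0 : Euc n) (2 * R)
      · rw [indicator_of_mem hx]
        refine (h𝒜.neg_flux_le (v := fun y => u y + (M + 1)) (η := η) (L := 2 * M + 1) (m := m)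
          (((hu1.differentiable one_ne_zero) x).hasFDerivAt.add_const _)
          ((hη.differentiable (by simp)) x) (hv1 x) (hvL x) (hη01 x).1 (hη01 x).2
          ((hdη x).trans hKR) (hp.one_lt.le.trans h1) h2 hm).trans ?_
        exact mul_le_mul_of_nonneg_left (hdη x) hD0
      · rw [indicator_of_notMem hx]
        have : fderiv ℝ φ x = 0 := image_eq_zero_of_notMem_tsupport fun h =>
          hx (closure_minimal (fun y (hy : φ y ≠ 0) => by_contra fun h' => hy (hφz y h'))
            isClosed_closedBall (tsupport_fderiv_subset ℝ h))
        simp [this]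
  have hV : 0 < volume.real (ball (0 : Euc n) 1) :=
    ENNReal.toReal_pos (measure_ball_pos _ _ one_pos).ne' measure_ball_lt_top.ne
  have hfin := hlow.trans (hmain.trans hupp)
  rw [Measure.addHaar_real_closedBall _ _ hR0.le,
    Measure.addHaar_real_closedBall _ _ (by positivity), finrank_euclideanSpace_fin, mul_pow] at hfin
  have hRn : 0 < R ^ n * volume.real (ball (0 : Euc n) 1) := by positivity
  have h1 : c ≤ D * (K / R) * 2 ^ n := by
    refine le_of_mul_le_mul_right ?_ hRn
    linarith
  calc c * R ≤ D * (K / R) * 2 ^ n * R := mul_le_mul_of_nonneg_right h1 hR0.le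
    _ = D * K * 2 ^ n := by field_simp

/-- Corollary 4.11: let `p⁻ > n` and let `f` be continuous, nonnegative, strictly convex
with `f(t) ≠ 0` for all `t`. Then there exists no bounded supersolution of
`div 𝒜(x,u,∇u) = f(u)` in `ℝⁿ`. -/
theorem nonexistence_strictly_convex {n : ℕ} (p : Euc n → ℝ) (pm pP : ℝ)
    (hp : IsVarExp p pm pP) (hpn : (n : ℝ) < pm)
    (𝒜 : Euc n → ℝ → Euc n → Euc n) (am bP : ℝ)
    (h𝒜 : IsNSGrowth p 𝒜 am bP)
    (f : ℝ → ℝ) (hfc : Continuous f) (hf0 : ∀ t, 0 ≤ f t)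
    (hconv : StrictConvexOn ℝ Set.univ f) (hfne : ∀ t, f t ≠ 0) :
    ¬ ∃ (u : Euc n → ℝ) (M : ℝ),
        IsFSupersolution p 𝒜 f u ∧ ∀ x, |u x| ≤ M := by
  rintro ⟨u, M, hu, hM⟩
  have hM0 : 0 ≤ M := (abs_nonneg _).trans (hM 0)
  obtain ⟨t, -, ht⟩ := (isCompact_Icc (a := -M) (b := M)).exists_isMinOn
    ⟨0, by simpa using hM0⟩ hfc.continuousOn
  have hc : 0 < f t := (hf0 t).lt_of_ne' (hfne t)
  obtain ⟨C, R₀, hC⟩ := hu.exists_mul_le hp h𝒜 hfc hM hc.le fun x => ht (abs_le.1 (hM x))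
  have h := hC (max R₀ (C / f t + 1)) (le_max_left _ _)
  have h' : f t * (C / f t + 1) ≤ C :=
    (mul_le_mul_of_nonneg_left (le_max_right _ _) hc.le).trans h
  rw [mul_add, mul_div_cancel₀ _ hc.ne'] at h'
  linarith

end
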